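/- arXiv:1909.07589 — 4 statements merged into one kernel-verified Lean document; each statement's English description precedes it below -/
import Mathlib

section
/- Let X and Y be measurable spaces and let α : (Y → ℝ≥0∞) → (X → ℝ≥0∞) be a map such that: α f is measurable whenever f is measurable; α 0 = 0; α (f + g) = α f + α g and α (r • f) = r • (α f) for all measurable f, g : Y → ℝ≥0∞ and all r : ℝ≥0; and for every pointwise-nondecreasing sequence (f n) of measurable functions Y → ℝ≥0∞ one has α (fun y => ⨆ n, f n y) = fun x => ⨆ n, α (f n) x. Then there exists a unique kernel κ : Kernel X Y such that for every measurable f : Y → ℝ≥0∞ and every x : X, α f x = ∫⁻ y, f y ∂(κ x). (In particular κ x B = α (Set.indicator B 1) x for measurable B.) -/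
open MeasureTheory ProbabilityTheory
open scoped ENNReal NNReal

/-- Characterization of transition kernels via linear, positive, monotone-convergence
preserving operators on measurable functions (Lemma 36.2 of [CP]). -/
theorem kernel_of_linear_operator {X Y : Type*} [MeasurableSpace X] [MeasurableSpace Y]
    (α : (Y → ℝ≥0∞) → (X → ℝ≥0∞))
    (hmeas : ∀ f : Y → ℝ≥0∞, Measurable f → Measurable (α f))
    (hzero : α 0 = 0)
    (hadd : ∀ f g : Y → ℝ≥0∞, Measurable f → Measurable g → α (f + g) = α f + α g)
    (hsmul : ∀ (r : ℝ≥0) (f : Y → ℝ≥0∞), Measurable f → α (r • f) = r • α f)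
    (hsup : ∀ f : ℕ → Y → ℝ≥0∞, (∀ n, Measurable (f n)) → Monotone f →
      α (fun y => ⨆ n, f n y) = fun x => ⨆ n, α (f n) x) :
    ∃! κ : Kernel X Y, ∀ f : Y → ℝ≥0∞, Measurable f → ∀ x : X,
      α f x = ∫⁻ y, f y ∂(κ x) := by
  have hsum : ∀ f : ℕ → Y → ℝ≥0∞, (∀ n, Measurable (f n)) → ∀ x,
      α (fun y => ∑' n, f n y) x = ∑' n, α (f n) x := by
    intro f hf x
    have hsm : ∀ n, Measurable (∑ i ∈ Finset.range n, f i) := by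
      intro n
      have := Finset.measurable_sum (Finset.range n) fun i _ => hf i
      convert this using 1
      funext y
      simp
    have hfin : ∀ n, α (∑ i ∈ Finset.range n, f i) = ∑ i ∈ Finset.range n, α (f i) := by
      intro n
      induction n with
      | zero => simpa using hzero
      | succ n ih =>
        rw [Finset.sum_range_succ, Finset.sum_range_succ, hadd _ _ _ (hf n), ih]
        exact hsm n
    have h := hsup (fun n => ∑ i ∈ Finset.range n, f i)
      (fun n => hsm n)
      (fun m n hmn => Finset.sum_le_sum_of_subset (Finset.range_mono hmn))
    have h2 := congrFun h x
    simp only [hfin, Finset.sum_apply] at h2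
    simp only [ENNReal.tsum_eq_iSup_nat]
    exact h2
  have hind : ∀ s : Set Y, MeasurableSet s → Measurable (s.indicator (1 : Y → ℝ≥0∞)) :=
    fun s hs => measurable_one.indicator hs
  let μ : X → Measure Y := fun x => Measure.ofMeasurable
    (fun s _ => α (s.indicator 1) x) (by rw [Set.indicator_empty']; exact congrFun hzero x) (by
      intro s hs hd
      rw [← hsum _ (fun n => hind _ (hs n)) x]
      congr 1
      congr 1
      funext y
      have := measure_iUnion (μ := Measure.dirac y) hd hs
      simpa [Measure.dirac_apply' _ (MeasurableSet.iUnion hs),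
        Measure.dirac_apply' _ (hs _)] using this)
  have hμ : ∀ x s, MeasurableSet s → μ x s = α (s.indicator 1) x :=
    fun x s hs => Measure.ofMeasurable_apply s hs
  have hμm : Measurable μ := by
    refine Measure.measurable_of_measurable_coe _ fun s hs => ?_
    simp only [hμ _ s hs]
    exact hmeas _ (hind s hs)
  refine ⟨⟨μ, hμm⟩, ?_, ?_⟩
  · intro f hf x
    change α f x = ∫⁻ y, f y ∂(μ x)
    have hc : ∀ (c : ℝ≥0) (s : Set Y), MeasurableSet s →
        α (s.indicator fun _ => (c : ℝ≥0∞)) x = c * μ x s := by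
      intro c s hs
      have e : (s.indicator fun _ => (c : ℝ≥0∞)) = c • s.indicator (1 : Y → ℝ≥0∞) := by
        funext y
        by_cases hy : y ∈ s <;> simp [hy, ENNReal.smul_def]
      rw [e, hsmul _ _ (hind s hs), hμ x s hs]
      rfl
    refine Measurable.ennreal_induction (motive := fun f => α f x = ∫⁻ y, f y ∂(μ x)) ?_ ?_ ?_ hf
    · intro c s hs
      rw [lintegral_indicator_const hs]
      induction c with
      | coe c => exact hc c s hs
      | top =>
        have e : (s.indicator fun _ => (⊤ : ℝ≥0∞)) =
            fun y => ⨆ n : ℕ, s.indicator (fun _ => (((n : ℝ≥0)) : ℝ≥0∞)) y := by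
          funext y
          by_cases hy : y ∈ s <;> simp [hy, ENNReal.iSup_natCast]
        rw [e, hsup _ (fun n => measurable_const.indicator hs)]
        · simp only [hc _ s hs]
          rw [← ENNReal.iSup_mul]
          simp [ENNReal.iSup_natCast]
        · intro m n hmn
          intro y
          by_cases hy : y ∈ s
          · simpa [hy] using hmn
          · simp [hy]
    · intro f g _ hf hg ihf ihg
      rw [hadd f g hf hg, Pi.add_apply, ihf, ihg, ← lintegral_add_left hf]
      rfl
    · intro f hf hm ih
      rw [hsup f hf hm, lintegral_iSup hf hm]
      simp only [ih]
  · intro κ hκ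
    ext x s hs
    change κ x s = μ x s
    rw [hμ x s hs, hκ _ (hind s hs) x, lintegral_indicator_one hs]
end

section
/- Let C be a monoidal category with unit object 𝟙 and suppose given, for each object R, a relation perp R between morphisms u : 𝟙 ⟶ R and morphisms x : R ⟶ 𝟙. Assume reciprocity: for all objects R, S, all f : R ⟶ S, u : 𝟙 ⟶ R and x : S ⟶ 𝟙, perp R u (f ≫ x) holds iff perp S (u ≫ f) x holds. Then perp is an orthogonality: (isomorphism) for every isomorphism ι : R ≅ S and all u : 𝟙 ⟶ R, x : R ⟶ 𝟙, perp R u x iff perp S (u ≫ ι.hom) (ι.inv ≫ x); (identity) perp R u x implies perp 𝟙 (𝟙_𝟙 as identity morphism) (u ≫ x); and (tensor, in the strengthened iff form) for all u : 𝟙 ⟶ R, v : 𝟙 ⟶ S and h : R ⊗ S ⟶ 𝟙, perp R u ((ρ_R).inv ≫ (𝟙_R ⊗ v) ≫ h) iff perp (R ⊗ S) ((λ_𝟙).inv ≫ (u ⊗ v)) h, and likewise perp S v ((λ_S).inv ≫ (u ⊗ 𝟙_S) ≫ h) iff perp (R ⊗ S) ((λ_𝟙).inv ≫ (u ⊗ v))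 h. -/
open CategoryTheory MonoidalCategory

/-- A reciprocal family of relations between morphisms `𝟙 ⟶ R` and `R ⟶ 𝟙` in a
monoidal category is a Hyland–Schalk orthogonality: it satisfies the isomorphism,
identity and (strengthened, iff-form) tensor conditions. -/
theorem reciprocal_is_orthogonality {C : Type*} [Category C] [MonoidalCategory C]
    (perp : ∀ R : C, (𝟙_ C ⟶ R) → (R ⟶ 𝟙_ C) → Prop)
    (hrec : ∀ (R S : C) (f : R ⟶ S) (u : 𝟙_ C ⟶ R) (x : S ⟶ 𝟙_ C),
      perp R u (f ≫ x) ↔ perp S (u ≫ f) x) :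
    (∀ (R S : C) (ι : R ≅ S) (u : 𝟙_ C ⟶ R) (x : R ⟶ 𝟙_ C),
      perp R u x ↔ perp S (u ≫ ι.hom) (ι.inv ≫ x)) ∧
    (∀ (R : C) (u : 𝟙_ C ⟶ R) (x : R ⟶ 𝟙_ C),
      perp R u x → perp (𝟙_ C) (𝟙 (𝟙_ C)) (u ≫ x)) ∧
    (∀ (R S : C) (u : 𝟙_ C ⟶ R) (v : 𝟙_ C ⟶ S) (h : R ⊗ S ⟶ 𝟙_ C),
      (perp R u ((ρ_ R).inv ≫ (𝟙 R ⊗ₘ v) ≫ h) ↔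
        perp (R ⊗ S) ((λ_ (𝟙_ C)).inv ≫ (u ⊗ₘ v)) h) ∧
      (perp S v ((λ_ S).inv ≫ (u ⊗ₘ 𝟙 S) ≫ h) ↔
        perp (R ⊗ S) ((λ_ (𝟙_ C)).inv ≫ (u ⊗ₘ v)) h)) := by
  refine ⟨fun R S ι u x => ?_, fun R u x hx => ?_, fun R S u v h => ⟨?_, ?_⟩⟩
  · rw [← hrec, Iso.hom_inv_id_assoc]
  · rw [hrec, Category.id_comp]
    exact hx
  · rw [← Category.assoc, hrec]
    have e : u ≫ (ρ_ R).inv ≫ (𝟙 R ⊗ₘ v) = (λ_ (𝟙_ C)).inv ≫ (u ⊗ₘ v) := by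
      rw [id_tensorHom, rightUnitor_inv_naturality_assoc, unitors_inv_equal, MonoidalCategory.tensorHom_def]
    rw [e]
  · rw [← Category.assoc, hrec]
    have e : v ≫ (λ_ S).inv ≫ (u ⊗ₘ 𝟙 S) = (λ_ (𝟙_ C)).inv ≫ (u ⊗ₘ v) := by
      rw [tensorHom_id, leftUnitor_inv_naturality_assoc, MonoidalCategory.tensorHom_def']
    rw [e]
end

section
/- Let C be a monoidal category with unit object 𝟙 and let perp be a reciprocal family of relations between morphisms 𝟙 ⟶ R and R ⟶ 𝟙 (i.e. perp R u (f ≫ x) ↔ perp S (u ≫ f) x for all f : R ⟶ S). For U ⊆ Hom(𝟙, R) set U° = { x : R ⟶ 𝟙 | ∀ u ∈ U, perp R u x }, for Y ⊆ Hom(R, 𝟙) set Y° = { u : 𝟙 ⟶ R | ∀ x ∈ Y, perp R u x }, and for U ⊆ Hom(𝟙, R), V ⊆ Hom(𝟙, S) set U ⊗ V = { (λ_𝟙).inv ≫ (u ⊗ v) | u ∈ U, v ∈ V } ⊆ Hom(𝟙, R ⊗ S). Then the tensor is stable: (U°° ⊗ V°°)° = (U°° ⊗ V)° = (U ⊗ V°°)°.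 -/
open CategoryTheory MonoidalCategory

/-- The polar of a set of points `𝟙 ⟶ R` with respect to a family of relations. -/
def rightPolar {C : Type*} [Category C] [MonoidalCategory C]
    (perp : ∀ R : C, (𝟙_ C ⟶ R) → (R ⟶ 𝟙_ C) → Prop) {R : C}
    (U : Set (𝟙_ C ⟶ R)) : Set (R ⟶ 𝟙_ C) :=
  {x | ∀ u ∈ U, perp R u x}

/-- The polar of a set of copoints `R ⟶ 𝟙` with respect to a family of relations. -/
def leftPolar {C : Type*} [Category C] [MonoidalCategory C]
    (perp : ∀ R : C, (𝟙_ C ⟶ R) → (R ⟶ 𝟙_ C) → Prop) {R : C}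
    (Y : Set (R ⟶ 𝟙_ C)) : Set (𝟙_ C ⟶ R) :=
  {u | ∀ x ∈ Y, perp R u x}

/-- The element-wise tensor product of two sets of points. -/
def tensorSet {C : Type*} [Category C] [MonoidalCategory C] {R S : C}
    (U : Set (𝟙_ C ⟶ R)) (V : Set (𝟙_ C ⟶ S)) : Set (𝟙_ C ⟶ R ⊗ S) :=
  {w | ∃ u ∈ U, ∃ v ∈ V, w = (λ_ (𝟙_ C)).inv ≫ (u ⊗ₘ v)}

theorem aux_v {C : Type*} [Category C] [MonoidalCategory C] {R S : C}
    (u : 𝟙_ C ⟶ R) (v : 𝟙_ C ⟶ S) :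
    (λ_ (𝟙_ C)).inv ≫ (u ⊗ₘ v) = v ≫ ((λ_ S).inv ≫ u ▷ S) := by
  rw [MonoidalCategory.tensorHom_def', ← Category.assoc, ← Category.assoc,
    leftUnitor_inv_naturality]

theorem aux_u {C : Type*} [Category C] [MonoidalCategory C] {R S : C}
    (u : 𝟙_ C ⟶ R) (v : 𝟙_ C ⟶ S) :
    (λ_ (𝟙_ C)).inv ≫ (u ⊗ₘ v) = u ≫ ((ρ_ R).inv ≫ R ◁ v) := by
  rw [MonoidalCategory.tensorHom_def, unitors_inv_equal, ← Category.assoc, ← Category.assoc,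
    rightUnitor_inv_naturality]

/-- Any reciprocal orthogonality on a monoidal category stabilises the tensor:
`(U°° ⊗ V°°)° = (U°° ⊗ V)° = (U ⊗ V°°)°`. -/
theorem reciprocal_orthogonality_stable_tensor
    {C : Type*} [Category C] [MonoidalCategory C]
    (perp : ∀ R : C, (𝟙_ C ⟶ R) → (R ⟶ 𝟙_ C) → Prop)
    (hrec : ∀ (R S : C) (f : R ⟶ S) (u : 𝟙_ C ⟶ R) (x : S ⟶ 𝟙_ C),
      perp R u (f ≫ x) ↔ perp S (u ≫ f) x)
    {R S : C} (U : Set (𝟙_ C ⟶ R)) (V : Set (𝟙_ C ⟶ S)) :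
    rightPolar perp (tensorSet (leftPolar perp (rightPolar perp U))
        (leftPolar perp (rightPolar perp V))) =
      rightPolar perp (tensorSet (leftPolar perp (rightPolar perp U)) V) ∧
    rightPolar perp (tensorSet (leftPolar perp (rightPolar perp U))
        (leftPolar perp (rightPolar perp V))) =
      rightPolar perp (tensorSet U (leftPolar perp (rightPolar perp V))) := by
  constructor
  · ext x
    constructor
    · rintro h _ ⟨u, hu, v, hv, rfl⟩
      exact h _ ⟨u, hu, v, fun y hy => hy v hv, rfl⟩
    · rintro h _ ⟨u, hu, v, hv, rfl⟩
      rw [aux_v, ← hrec]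
      apply hv
      intro v' hv'
      rw [hrec, ← aux_v]
      exact h _ ⟨u, hu, v', hv', rfl⟩
  · ext x
    constructor
    · rintro h _ ⟨u, hu, v, hv, rfl⟩
      exact h _ ⟨u, fun y hy => hy u hu, v, hv, rfl⟩
    · rintro h _ ⟨u, hu, v, hv, rfl⟩
      rw [aux_u, ← hrec]
      apply hu
      intro u' hu'
      rw [hrec, ← aux_u]
      exact h _ ⟨u', hu', v, hv, rfl⟩
end

section
/- Let X, Y, Z be countable types each equipped with the discrete σ-algebra in which every subset is measurable (Mathlib `Countable` and `DiscreteMeasurableSpace`), and give X × Y and Y × Z the product σ-algebras. Then for every kernel κ : Kernel (X × Y) Z there exists a unique kernel κ' : Kernel X (Y × Z) such that κ' x {(y, z)} = κ (x, y) {z} for all x : X, y : Y, z : Z. -/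
open MeasureTheory ProbabilityTheory
open scoped ENNReal

/-- Currying of transition matrices between countable discrete measurable spaces
(the compact closed structure): every kernel `Kernel (X × Y) Z` corresponds to a
unique kernel `Kernel X (Y × Z)` with the same matrix entries. -/
theorem kernel_curry_unique
    {X Y Z : Type*} [MeasurableSpace X] [MeasurableSpace Y] [MeasurableSpace Z]
    [Countable X] [Countable Y] [Countable Z]
    [DiscreteMeasurableSpace X] [DiscreteMeasurableSpace Y] [DiscreteMeasurableSpace Z]
    (κ : Kernel (X × Y) Z) :
    ∃! κ' : Kernel X (Y × Z), ∀ (x : X) (y : Y) (z : Z),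
      κ' x {(y, z)} = κ (x, y) {z} := by
  refine ⟨Kernel.ofFunOfCountable fun x =>
    Measure.sum fun p : Y × Z => κ (x, p.1) {p.2} • Measure.dirac p, ?_, ?_⟩
  · intro x y z
    exact Measure.sum_smul_dirac_singleton (f := fun p : Y × Z => κ (x, p.1) {p.2})
  · intro η hη
    ext1 x
    refine Measure.ext_of_singleton ?_
    rintro ⟨y, z⟩
    rw [hη]
    exact (Measure.sum_smul_dirac_singleton (f := fun p : Y × Z => κ (x, p.1) {p.2}) (a := (y, z))).symm
end
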